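/- Fix n ≥ 1 and q ∈ ℂ nonzero and not a root of unity. Let V be the complex vector space of finitely supported functions (Fin n → ℕ) → ℂ, and for 1 ≤ i ≤ n let b_i, c_i, k_i be the linear operators acting on the i-th coordinate as the Fock operators b, c, k (b|m⟩=|m+1⟩, c|m⟩=(1−q^m)|m−1⟩, k|m⟩=q^m|m⟩) and as the identity on the other coordinates. Let λ, μ ∈ ℂ with λ ≠ 0, s ∈ ℤ_{≥0}^n, α ∈ ℤ_{≥0}^{n+1}, with (μ;q)_{|s|} ≠ 0 and (μ;q)_{|α|} ≠ 0. Then, as linear operators on V: Σ_{m ∈ ℤ_{≥0}^n, m ≤ s} q^{φ(m,α)} Φ_q^{(n)}(m|s;λ,μ) ∏_{i=1}^{n} b_i^{s_i−m_i} c_i^{α_i} b_i^{m_i} = Σ_{γ ∈ ℤ_{≥0}^{n+1}, γ ≤ α} q^{φ(γ,α) + φ(s,γ) − φ(α,γ)} Φ_q^{(n+1)}(γ|α;λ,μ) ∏_{i=1}^{n} c_i^{γ_i} b_i^{s_i} c_i^{α_i−γ_i}, where in φ(m,α) and φ(s,γ) the length-n vector is padded with a trailing zero to length n+1, and the products over i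 are compositions of pairwise commuting operators. -/

import Mathlib

/-- The q-Pochhammer symbol `(z;q)_m = ∏_{j=0}^{m-1} (1 - z q^j)`. -/
noncomputable def qPoch (q z : ℂ) (m : ℕ) : ℂ := ∏ j ∈ Finset.range m, (1 - z * q ^ j)

/-- The q-binomial coefficient `binom(m,k)_q`. -/
noncomputable def qBinom (q : ℂ) (m k : ℕ) : ℂ :=
  if k ≤ m then qPoch q q m / (qPoch q q k * qPoch q q (m - k)) else 0

/-- `q` is not a root of unity. -/
def notRootOfUnity (q : ℂ) : Prop := ∀ m : ℕ, 0 < m → q ^ m ≠ 1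

/-- `φ(β,γ) = Σ_{1 ≤ i < j ≤ k} β_i γ_j` for integer vectors. -/
def phi {k : ℕ} (β γ : Fin k → ℤ) : ℤ :=
  ∑ i, ∑ j, if i < j then β i * γ j else 0

open Classical in
/-- The weight `Φ_q^{(n)}(γ|β;λ,μ)` of the stochastic R matrix of `U_q(A^{(1)}_n)`. -/
noncomputable def Phi (n : ℕ) (q lam mu : ℂ) (γ β : Fin n → ℕ) : ℂ :=
  if γ ≤ β then
    q ^ phi (fun i => (β i : ℤ) - (γ i : ℤ)) (fun i => (γ i : ℤ))
      * (mu / lam) ^ (∑ i, γ i)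
      * qPoch q lam (∑ i, γ i) * qPoch q (mu / lam) ((∑ i, β i) - ∑ i, γ i)
      * (∏ i, qBinom q (β i) (γ i)) / qPoch q mu (∑ i, β i)
  else 0


/-- The `n`-fold tensor power of the Fock space, as finitely supported functions on
occupation-number configurations. -/
abbrev FockPow (n : ℕ) := (Fin n → ℕ) →₀ ℂ

/-- The creation operator `b_i` acting on the `i`-th tensor factor: `b|m⟩ = |m+1⟩`. -/
noncomputable def Bop (n : ℕ) (i : Fin n) : Module.End ℂ (FockPow n) :=
  Finsupp.lsum ℂ fun f => LinearMap.toSpanSingleton ℂ (FockPow n)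
    (Finsupp.single (Function.update f i (f i + 1)) 1)

/-- The annihilation operator `c_i` acting on the `i`-th tensor factor:
`c|m⟩ = (1−q^m)|m−1⟩`. -/
noncomputable def Cop (n : ℕ) (q : ℂ) (i : Fin n) : Module.End ℂ (FockPow n) :=
  Finsupp.lsum ℂ fun f => LinearMap.toSpanSingleton ℂ (FockPow n)
    ((1 - q ^ f i) • Finsupp.single (Function.update f i (f i - 1)) 1)

/-- The operator `k_i` acting on the `i`-th tensor factor: `k|m⟩ = q^m|m⟩`. -/
noncomputable def Kop (n : ℕ) (q : ℂ) (i : Fin n) : Module.End ℂ (FockPow n) :=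
  Finsupp.lsum ℂ fun f => LinearMap.toSpanSingleton ℂ (FockPow n)
    (q ^ f i • Finsupp.single f 1)

theorem qPoch_zero (q z : ℂ) : qPoch q z 0 = 1 := by simp [qPoch]

theorem qPoch_succ (q z : ℂ) (m : ℕ) :
    qPoch q z (m + 1) = qPoch q z m * (1 - z * q ^ m) := by
  simp [qPoch, Finset.prod_range_succ]

theorem qPoch_add (q z : ℂ) (m k : ℕ) :
    qPoch q z (m + k) = qPoch q z m * qPoch q (z * q ^ m) k := by
  simp only [qPoch, Finset.prod_range_add]
  congr 1
  refine Finset.prod_congr rfl fun j _ => ?_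
  ring

theorem qPoch_succ' (q z : ℂ) (m : ℕ) :
    qPoch q z (m + 1) = (1 - z) * qPoch q (z * q) m := by
  rw [add_comm, qPoch_add]
  simp [qPoch]

theorem qPoch_self_ne_zero {q : ℂ} (hq : notRootOfUnity q) (m : ℕ) : qPoch q q m ≠ 0 := by
  refine Finset.prod_ne_zero_iff.2 fun j _ => sub_ne_zero.2 fun h => ?_
  exact hq (j + 1) j.succ_pos (by rw [pow_succ', ← h])

theorem qPoch_ne_zero_of_le {q z : ℂ} {m k : ℕ} (h : m ≤ k) (hk : qPoch q z k ≠ 0) :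
    qPoch q z m ≠ 0 := by
  obtain ⟨d, rfl⟩ := Nat.exists_eq_add_of_le h
  rw [qPoch_add] at hk
  exact left_ne_zero_of_mul hk

theorem qBinom_of_add_eq (q : ℂ) {m k n : ℕ} (h : m + k = n) :
    qBinom q n m = qPoch q q n / (qPoch q q m * qPoch q q k) := by
  subst h
  simp [qBinom]

theorem qBinom_eq_zero {q : ℂ} {m k : ℕ} (h : m < k) : qBinom q m k = 0 := by
  simp [qBinom, h]

theorem qBinom_zero_right {q : ℂ} (hq : notRootOfUnity q) (m : ℕ) : qBinom q m 0 = 1 := by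
  simp [qBinom, qPoch_zero, qPoch_self_ne_zero hq]

theorem qBinom_succ_succ {q : ℂ} (hq : notRootOfUnity q) (m k : ℕ) :
    qBinom q (m + 1) (k + 1) = qBinom q m k + q ^ (k + 1) * qBinom q m (k + 1) := by
  rcases lt_trichotomy m k with h | rfl | h
  · rw [qBinom_eq_zero h, qBinom_eq_zero (by lia), qBinom_eq_zero (by lia)]
    simp
  · rw [qBinom_eq_zero (Nat.lt_succ_self m)]
    simp [qBinom, qPoch_zero, qPoch_self_ne_zero hq]
  · obtain ⟨d, rfl⟩ := Nat.exists_eq_add_of_lt h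
    rw [qBinom_of_add_eq q (show k + (d + 1) = k + d + 1 by lia),
      qBinom_of_add_eq q (show k + 1 + d = k + d + 1 by lia),
      qBinom_of_add_eq q (show k + 1 + (d + 1) = k + d + 1 + 1 by lia)]
    have hk := qPoch_self_ne_zero hq (k + 1)
    have hd := qPoch_self_ne_zero hq (d + 1)
    rw [qPoch_succ] at hk hd
    rw [qPoch_succ q q (k + d + 1), qPoch_succ q q k, qPoch_succ q q d]
    have hk1 := left_ne_zero_of_mul hk
    have hk2 := right_ne_zero_of_mul hk
    have hd1 := left_ne_zero_of_mul hd
    have hd2 := right_ne_zero_of_mul hd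
    field_simp
    ring

theorem qBinom_succ_mul {q : ℂ} (hq : notRootOfUnity q) {m k : ℕ} (h : k ≤ m) :
    qBinom q m (k + 1) * (1 - q ^ (k + 1)) = qBinom q m k * (1 - q ^ (m - k)) := by
  rcases h.eq_or_lt with rfl | h
  · simp [qBinom_eq_zero (Nat.lt_succ_self k)]
  · obtain ⟨d, rfl⟩ := Nat.exists_eq_add_of_lt h
    rw [qBinom_of_add_eq q (show k + (d + 1) = k + d + 1 by lia),
      qBinom_of_add_eq q (show k + 1 + d = k + d + 1 by lia), show k + d + 1 - k = d + 1 by lia]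
    have hk := qPoch_self_ne_zero hq (k + 1)
    have hd := qPoch_self_ne_zero hq (d + 1)
    rw [qPoch_succ] at hk hd
    rw [qPoch_succ q q k, qPoch_succ q q d]
    have hk1 := left_ne_zero_of_mul hk
    have hk2 := right_ne_zero_of_mul hk
    have hd1 := left_ne_zero_of_mul hd
    have hd2 := right_ne_zero_of_mul hd
    field_simp
    ring

theorem sum_qBinom_succ_mul {q : ℂ} (hq : notRootOfUnity q) (a : ℕ) (F : ℕ → ℂ) :
    ∑ g ∈ Finset.range (a + 2), qBinom q (a + 1) g * F g
      = ∑ g ∈ Finset.range (a + 1), qBinom q a g * F (g + 1)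
        + ∑ g ∈ Finset.range (a + 1), q ^ g * qBinom q a g * F g := by
  have e : ∑ g ∈ Finset.range (a + 2), q ^ g * qBinom q a g * F g
      = ∑ g ∈ Finset.range (a + 1), q ^ g * qBinom q a g * F g := by
    rw [Finset.sum_range_succ, qBinom_eq_zero (Nat.lt_succ_self a)]
    simp
  rw [← e, Finset.sum_range_succ', Finset.sum_range_succ' _ (a + 1), ← add_assoc,
    ← Finset.sum_add_distrib, qBinom_zero_right hq, qBinom_zero_right hq]
  congr 1
  · refine Finset.sum_congr rfl fun g _ => ?_
    rw [qBinom_succ_succ hq]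
    ring
  · simp

theorem sum_qBinom_mul_pow_mul_qPoch {q : ℂ} (hq : notRootOfUnity q) (s : ℕ) (u : ℂ) :
    ∑ m ∈ Finset.range (s + 1), qBinom q s m * (u ^ m * qPoch q u (s - m)) = 1 := by
  induction s generalizing u with
  | zero => simp [qBinom_zero_right hq, qPoch_zero]
  | succ s ih =>
    have h1 := congrArg (u * ·) (ih u)
    have h2 := congrArg ((1 - u) * ·) (ih (u * q))
    simp only [Finset.mul_sum] at h1 h2
    rw [sum_qBinom_succ_mul hq]
    refine (congrArg₂ (· + ·) (Eq.trans ?_ h1) (Eq.trans ?_ h2)).trans (by ring)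
    · refine Finset.sum_congr rfl fun m _ => ?_
      rw [Nat.add_sub_add_right]
      ring
    · refine Finset.sum_congr rfl fun m hm => ?_
      have hm : m ≤ s := Nat.lt_succ_iff.1 (Finset.mem_range.1 hm)
      rw [Nat.succ_sub hm, Nat.succ_eq_add_one, qPoch_succ']
      ring

/-- The recursion in `a` of the left-hand side of `sum_qBinom_shift_eq`. -/
theorem sum_qBinom_shift_succ {q : ℂ} (hq0 : q ≠ 0) (hq : notRootOfUnity q) (s a : ℕ) (u x : ℂ) :
    ∑ m ∈ Finset.range (s + 1),
        qBinom q s m * (u ^ m * qPoch q u (s - m) * qPoch q⁻¹ (x * q ^ m) (a + 1))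
      = (1 - u) * (1 - x) * ∑ m ∈ Finset.range (s + 1),
          qBinom q s m * ((u * q) ^ m * qPoch q (u * q) (s - m)
            * qPoch q⁻¹ (x * q⁻¹ * q ^ m) a)
        + u * (1 - x * q ^ s * q⁻¹ ^ a) * ∑ m ∈ Finset.range (s + 1),
          qBinom q s m * (u ^ m * qPoch q u (s - m) * qPoch q⁻¹ (x * q ^ m) a) := by
  have key := Finset.sum_range_sub (fun m => qBinom q s m * (1 - q ^ m) * (u ^ m
    * qPoch q u (s + 1 - m) * qPoch q⁻¹ (x * q⁻¹ * q ^ m) a)) (s + 1)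
  rw [qBinom_eq_zero (Nat.lt_succ_self s)] at key
  simp only [pow_zero, sub_self, mul_zero, zero_mul] at key
  rw [Finset.mul_sum, Finset.mul_sum, ← Finset.sum_add_distrib, ← sub_eq_zero,
    ← Finset.sum_sub_distrib, ← neg_eq_zero, ← key, ← Finset.sum_neg_distrib]
  refine Finset.sum_congr rfl fun m hm => ?_
  have hm : m ≤ s := Nat.lt_succ_iff.1 (Finset.mem_range.1 hm)
  rw [qBinom_succ_mul hq hm]
  obtain ⟨d, rfl⟩ := Nat.exists_eq_add_of_le hm
  have h1 : x * q⁻¹ * q ^ (m + 1) = x * q ^ m := by field_simp; ring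
  have h2 : (x * q ^ m) * q⁻¹ = x * q⁻¹ * q ^ m := by ring
  have h3 := qPoch_succ q⁻¹ (x * q ^ m) a
  rw [qPoch_succ', h2] at h3
  have h4 := qPoch_succ' q u d
  rw [qPoch_succ] at h4
  rw [h1, show m + d + 1 - (m + 1) = d by lia, show m + d + 1 - m = d + 1 by lia,
    show m + d - m = d by lia, qPoch_succ', h2, qPoch_succ]
  rw [mul_pow, pow_succ u, pow_add q]
  generalize qPoch q⁻¹ (x * q ^ m) a = P at *
  generalize qPoch q⁻¹ (x * q⁻¹ * q ^ m) a = h at *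
  generalize qPoch q u d = V at *
  generalize qPoch q (u * q) d = W at *
  generalize qBinom q (m + d) m = B
  generalize q⁻¹ ^ a = r at *
  linear_combination (B * u ^ m * (1 - x) * q ^ m * h) * (-h4) - B * u ^ m * V * u * q ^ d * h3

theorem sum_qBinom_raise_succ {q : ℂ} (hq : notRootOfUnity q) (y u x : ℂ) (a : ℕ) :
    ∑ g ∈ Finset.range (a + 2),
        qBinom q (a + 1) g * (u ^ g * qPoch q u (a + 1 - g) * (qPoch q⁻¹ x (a + 1 - g)
          * qPoch q⁻¹ (x * y * q⁻¹ ^ (a + 1 - g)) g))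
      = (1 - u) * (1 - x) * ∑ g ∈ Finset.range (a + 1),
          qBinom q a g * ((u * q) ^ g * qPoch q (u * q) (a - g) * (qPoch q⁻¹ (x * q⁻¹) (a - g)
            * qPoch q⁻¹ (x * q⁻¹ * y * q⁻¹ ^ (a - g)) g))
        + u * (1 - x * y * q⁻¹ ^ a) * ∑ g ∈ Finset.range (a + 1),
          qBinom q a g * (u ^ g * qPoch q u (a - g) * (qPoch q⁻¹ x (a - g)
            * qPoch q⁻¹ (x * y * q⁻¹ ^ (a - g)) g)) := by
  rw [sum_qBinom_succ_mul hq, add_comm, Finset.mul_sum, Finset.mul_sum]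
  congr 1
  · refine Finset.sum_congr rfl fun g hg => ?_
    have hg : g ≤ a := Nat.lt_succ_iff.1 (Finset.mem_range.1 hg)
    obtain ⟨d, rfl⟩ := Nat.exists_eq_add_of_le hg
    rw [show g + d + 1 - g = d + 1 by lia, show g + d - g = d by lia, qPoch_succ', qPoch_succ',
      show x * y * q⁻¹ ^ (d + 1) = x * q⁻¹ * y * q⁻¹ ^ d by ring]
    ring
  · refine Finset.sum_congr rfl fun g hg => ?_
    have hg : g ≤ a := Nat.lt_succ_iff.1 (Finset.mem_range.1 hg)
    obtain ⟨d, rfl⟩ := Nat.exists_eq_add_of_le hg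
    rw [show g + d + 1 - (g + 1) = d by lia, show g + d - g = d by lia, qPoch_succ]
    rw [show x * y * q⁻¹ ^ d * q⁻¹ ^ g = x * y * q⁻¹ ^ (g + d) by ring]
    ring

theorem sum_qBinom_shift_eq {q : ℂ} (hq0 : q ≠ 0) (hq : notRootOfUnity q) (s a : ℕ) (u x : ℂ) :
    ∑ m ∈ Finset.range (s + 1),
        qBinom q s m * (u ^ m * qPoch q u (s - m) * qPoch q⁻¹ (x * q ^ m) a)
      = ∑ g ∈ Finset.range (a + 1),
          qBinom q a g * (u ^ g * qPoch q u (a - g) * (qPoch q⁻¹ x (a - g)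
            * qPoch q⁻¹ (x * q ^ s * q⁻¹ ^ (a - g)) g)) := by
  induction a generalizing u x with
  | zero =>
    simpa [qBinom_zero_right hq, qPoch_zero] using sum_qBinom_mul_pow_mul_qPoch hq s u
  | succ a ih => rw [sum_qBinom_shift_succ hq0 hq, sum_qBinom_raise_succ hq, ih, ih]

/-- The pairing `phi` on vectors of natural numbers. -/
def natPhi {k : ℕ} (β γ : Fin k → ℕ) : ℕ :=
  ∑ i, ∑ j, if i < j then β i * γ j else 0

theorem phi_natCast {k : ℕ} (β γ : Fin k → ℕ) :
    phi (fun i => (β i : ℤ)) (fun i => (γ i : ℤ)) = natPhi β γ := by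
  simp [phi, natPhi]

theorem natPhi_cons {k : ℕ} (b c : ℕ) (β γ : Fin k → ℕ) :
    natPhi (Fin.cons b β : Fin (k + 1) → ℕ) (Fin.cons c γ) = b * ∑ i, γ i + natPhi β γ := by
  simp [natPhi, Fin.sum_univ_succ, Finset.mul_sum]

theorem natPhi_add_left {k : ℕ} (β β' γ : Fin k → ℕ) :
    natPhi (β + β') γ = natPhi β γ + natPhi β' γ := by
  simp only [natPhi, ← Finset.sum_add_distrib]
  refine Finset.sum_congr rfl fun i _ => Finset.sum_congr rfl fun j _ => ?_
  split_ifs <;> simp [add_mul]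

theorem natPhi_add_right {k : ℕ} (β γ γ' : Fin k → ℕ) :
    natPhi β (γ + γ') = natPhi β γ + natPhi β γ' := by
  simp only [natPhi, ← Finset.sum_add_distrib]
  refine Finset.sum_congr rfl fun i _ => Finset.sum_congr rfl fun j _ => ?_
  split_ifs <;> simp [mul_add]

theorem sum_add_sum_sub {k : ℕ} {β γ : Fin k → ℕ} (h : γ ≤ β) :
    ∑ i, γ i + ∑ i, (β - γ) i = ∑ i, β i := by
  rw [← Finset.sum_add_distrib]
  exact Finset.sum_congr rfl fun i _ => Nat.add_sub_cancel' (h i)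

theorem cons_sub_cons {k : ℕ} (b c : ℕ) (β γ : Fin k → ℕ) :
    (Fin.cons b β : Fin (k + 1) → ℕ) - Fin.cons c γ = Fin.cons (b - c) (β - γ) := by
  funext i
  refine Fin.cases ?_ (fun j => ?_) i <;> simp

theorem sum_Iic_cons {M : Type*} [AddCommMonoid M] {k : ℕ} (a : ℕ) (s : Fin k → ℕ)
    (F : (Fin (k + 1) → ℕ) → M) :
    ∑ m ∈ Finset.Iic (Fin.cons a s : Fin (k + 1) → ℕ), F m
      = ∑ m₀ ∈ Finset.range (a + 1), ∑ m ∈ Finset.Iic s, F (Fin.cons m₀ m) := by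
  rw [← Finset.sum_product']
  refine Finset.sum_nbij' (fun m => (m 0, Fin.tail m)) (fun p => Fin.cons p.1 p.2) ?_ ?_ ?_ ?_ ?_
  · intro m hm
    rw [Finset.mem_Iic] at hm
    simp only [Finset.mem_product, Finset.mem_range, Finset.mem_Iic]
    exact ⟨Nat.lt_succ_of_le (by simpa using hm 0), fun i => by simpa [Fin.tail] using hm i.succ⟩
  · rintro ⟨m₀, m⟩ hm
    simp only [Finset.mem_product, Finset.mem_range, Finset.mem_Iic] at hm
    rw [Finset.mem_Iic]
    intro i
    refine Fin.cases ?_ (fun j => ?_) i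
    · simpa using Nat.le_of_lt_succ hm.1
    · simpa using hm.2 j
  · intro m _
    simp
  · intro p _
    simp
  · intro m _
    simp

/-- The scalar identity behind `mrng_identity`, with the `q`-Hahn weights
`(μ/λ)^M (λ;q)_M (μ/λ;q)_N / (μ;q)_{M+N}` replaced by `t^M (t;q)_N`. -/
theorem sum_natPhi_pow_mul_qPoch_eq {q : ℂ} (hq0 : q ≠ 0) (hq : notRootOfUnity q) (n : ℕ)
    (s : Fin n → ℕ) (α : Fin (n + 1) → ℕ) (x : Fin n → ℂ) (t : ℂ) :
    ∑ m ∈ Finset.Iic s, q ^ (natPhi (Fin.snoc m 0 : Fin (n + 1) → ℕ) α + natPhi (s - m) m)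
        * (∏ i, qBinom q (s i) (m i)) * (∏ i, qPoch q⁻¹ (x i * q ^ m i) (α i.castSucc))
        * (t ^ (∑ i, m i) * qPoch q t (∑ i, (s - m) i))
      = ∑ γ ∈ Finset.Iic α,
        q ^ (natPhi γ (α - γ) + natPhi (Fin.snoc s 0 : Fin (n + 1) → ℕ) γ)
        * (∏ i, qBinom q (α i) (γ i))
        * (∏ i : Fin n, qPoch q⁻¹ (x i) (α i.castSucc - γ i.castSucc)
          * qPoch q⁻¹ (x i * q ^ s i * q⁻¹ ^ (α i.castSucc - γ i.castSucc)) (γ i.castSucc))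
        * (t ^ (∑ i, γ i) * qPoch q t (∑ i, (α - γ) i)) := by
  induction n generalizing t with
  | zero =>
    have e : Finset.Iic s = {s} := by
      ext m
      simp [Subsingleton.elim m s]
    obtain ⟨a, α', rfl⟩ : ∃ a α', α = Fin.cons a α' :=
      ⟨α 0, Fin.tail α, (Fin.cons_self_tail α).symm⟩
    have e' : Finset.Iic α' = {α'} := by
      ext m
      simp [Subsingleton.elim m α']
    rw [sum_Iic_cons, e, e']
    have h (β γ : Fin (0 + 1) → ℕ) : natPhi β γ = 0 := by simp [natPhi]
    have h' (β γ : Fin 0 → ℕ) : natPhi β γ = 0 := by simp [natPhi]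
    simpa [h, h', qPoch_zero] using (sum_qBinom_mul_pow_mul_qPoch hq a t).symm
  | succ n ih =>
    obtain ⟨a, α, rfl⟩ : ∃ a α', α = Fin.cons a α' :=
      ⟨α 0, Fin.tail α, (Fin.cons_self_tail α).symm⟩
    obtain ⟨s₀, s, rfl⟩ : ∃ a s', s = Fin.cons a s' :=
      ⟨s 0, Fin.tail s, (Fin.cons_self_tail s).symm⟩
    obtain ⟨x₀, x, rfl⟩ : ∃ a x', x = Fin.cons a x' :=
      ⟨x 0, Fin.tail x, (Fin.cons_self_tail x).symm⟩
    rw [sum_Iic_cons, sum_Iic_cons, Finset.sum_comm (s := Finset.range (a + 1))]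
    simp only [← Fin.cons_snoc_eq_snoc_cons, natPhi_cons, cons_sub_cons, Fin.prod_univ_succ,
      Fin.sum_cons, Fin.cons_zero, Fin.cons_succ, Fin.castSucc_zero, ← Fin.succ_castSucc]
    have hfold (γ : Fin (n + 1) → ℕ) :
        qBinom q (α 0) (γ 0) * ∏ i : Fin n, qBinom q (α i.succ) (γ i.succ)
          = ∏ i, qBinom q (α i) (γ i) := 
      (Fin.prod_univ_succ fun i => qBinom q (α i) (γ i)).symm
    simp only [hfold]
    have hL (m₀ : ℕ) := congrArg (q ^ (m₀ * ∑ i, α i) * qBinom q s₀ m₀ * qPoch q⁻¹ (x₀ * q ^ m₀) a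
      * (t ^ m₀ * qPoch q t (s₀ - m₀)) * ·) (ih s α x (t * q ^ (s₀ - m₀)))
    simp only [Finset.mul_sum (s := Finset.Iic _)] at hL
    trans ∑ m₀ ∈ Finset.range (s₀ + 1), ∑ γ ∈ Finset.Iic α,
      q ^ (m₀ * ∑ i, α i) * qBinom q s₀ m₀ * qPoch q⁻¹ (x₀ * q ^ m₀) a
        * (t ^ m₀ * qPoch q t (s₀ - m₀))
        * (q ^ (natPhi γ (α - γ) + natPhi (Fin.snoc s 0 : Fin (n + 1) → ℕ) γ)
        * (∏ i, qBinom q (α i) (γ i))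
        * (∏ i : Fin n, qPoch q⁻¹ (x i) (α i.castSucc - γ i.castSucc)
          * qPoch q⁻¹ (x i * q ^ s i * q⁻¹ ^ (α i.castSucc - γ i.castSucc)) (γ i.castSucc))
        * ((t * q ^ (s₀ - m₀)) ^ (∑ i, γ i)
          * qPoch q (t * q ^ (s₀ - m₀)) (∑ i, (α - γ) i)))
    · refine Finset.sum_congr rfl fun m₀ _ => Eq.trans ?_ (hL m₀)
      refine Finset.sum_congr rfl fun m _ => ?_
      rw [qPoch_add]
      ring
    · rw [Finset.sum_comm]
      refine Finset.sum_congr rfl fun γ hγ => ?_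
      rw [← sum_add_sum_sub (Finset.mem_Iic.1 hγ)]
      generalize ∑ i, γ i = G
      generalize ∑ i, (α - γ) i = N
      have key := congrArg (q ^ (natPhi γ (α - γ) + natPhi (Fin.snoc s 0 : Fin (n + 1) → ℕ) γ)
        * (∏ i, qBinom q (α i) (γ i))
        * (∏ i : Fin n, qPoch q⁻¹ (x i) (α i.castSucc - γ i.castSucc)
          * qPoch q⁻¹ (x i * q ^ s i * q⁻¹ ^ (α i.castSucc - γ i.castSucc)) (γ i.castSucc))
        * (t ^ G * qPoch q t N * q ^ (s₀ * G)) * ·) (sum_qBinom_shift_eq hq0 hq s₀ a (t * q ^ N) x₀)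
      simp only [Finset.mul_sum] at key
      refine Eq.trans ?_ (key.trans ?_)
      · refine Finset.sum_congr rfl fun m hm => ?_
        obtain ⟨d, rfl⟩ := Nat.exists_eq_add_of_le (Nat.lt_succ_iff.1 (Finset.mem_range.1 hm))
        rw [Nat.add_sub_cancel_left]
        have h : qPoch q t d * qPoch q (t * q ^ d) N = qPoch q t N * qPoch q (t * q ^ N) d := by
          rw [← qPoch_add, ← qPoch_add, add_comm]
        linear_combination (q ^ (m * (G + N)) * qBinom q (m + d) m * qPoch q⁻¹ (x₀ * q ^ m) a
          * (t ^ m) * (q ^ (natPhi γ (α - γ) + natPhi (Fin.snoc s 0 : Fin (n + 1) → ℕ) γ)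
          * (∏ i, qBinom q (α i) (γ i))
          * (∏ i : Fin n, qPoch q⁻¹ (x i) (α i.castSucc - γ i.castSucc)
            * qPoch q⁻¹ (x i * q ^ s i * q⁻¹ ^ (α i.castSucc - γ i.castSucc)) (γ i.castSucc))
          * ((t * q ^ d) ^ G))) * h
      · refine Finset.sum_congr rfl fun g _ => ?_
        rw [add_comm (a - g) N, qPoch_add]
        ring

open Polynomial in
/-- The linear functional on polynomials whose `k`-th moment is `ν^k (λ;q)_k / (λν;q)_k`. -/
noncomputable def qBetaMoment (q lam nu : ℂ) : ℂ[X] →ₗ[ℂ] ℂ :=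
  Polynomial.lsum fun k =>
    LinearMap.mulRight ℂ (nu ^ k * qPoch q lam k / qPoch q (lam * nu) k)

open Polynomial in
theorem qBetaMoment_X_pow_mul_prod {q lam nu : ℂ} (M N : ℕ)
    (h : qPoch q (lam * nu) (M + N) ≠ 0) :
    qBetaMoment q lam nu (X ^ M * ∏ j ∈ Finset.range N, (1 - C (q ^ j) * X))
      = nu ^ M * qPoch q lam M * qPoch q nu N / qPoch q (lam * nu) (M + N) := by
  induction N generalizing M with
  | zero => simp [qBetaMoment, qPoch_zero, X_pow_eq_monomial]
  | succ N ih =>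
    have h' := qPoch_ne_zero_of_le (Nat.le_succ (M + N)) h
    have e : (X ^ M * ∏ j ∈ Finset.range (N + 1), (1 - C (q ^ j) * X) : ℂ[X])
        = X ^ M * ∏ j ∈ Finset.range N, (1 - C (q ^ j) * X)
          - q ^ N • (X ^ (M + 1) * ∏ j ∈ Finset.range N, (1 - C (q ^ j) * X)) := by
      rw [Finset.prod_range_succ, smul_eq_C_mul]
      ring
    have hadd : M + 1 + N = M + (N + 1) := by ring
    rw [e, map_sub, map_smul, ih M h', ih (M + 1) (by rwa [hadd]), hadd]
    rw [← add_assoc, qPoch_succ] at h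
    rw [← add_assoc, qPoch_succ q (lam * nu), qPoch_succ q lam, qPoch_succ q nu, smul_eq_mul]
    have h1 := left_ne_zero_of_mul h
    have h2 := right_ne_zero_of_mul h
    field_simp
    ring

open Polynomial in
/-- An identity between combinations of `t^M (t;q)_N` with `M + N` fixed on either side persists
when `t^M (t;q)_N` is replaced by the `q`-Hahn weight. -/
theorem sum_qHahn_eq_of_sum_pow_mul_qPoch_eq {q lam nu : ℂ} {ι κ : Type*} (A : Finset ι)
    (B : Finset κ) (a : ι → ℂ) (b : κ → ℂ) (M N : ι → ℕ) (M' N' : κ → ℕ)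
    (hA : ∀ i ∈ A, qPoch q (lam * nu) (M i + N i) ≠ 0)
    (hB : ∀ i ∈ B, qPoch q (lam * nu) (M' i + N' i) ≠ 0)
    (h : ∀ t : ℂ, ∑ i ∈ A, a i * (t ^ M i * qPoch q t (N i))
      = ∑ i ∈ B, b i * (t ^ M' i * qPoch q t (N' i))) :
    ∑ i ∈ A, a i * (nu ^ M i * qPoch q lam (M i) * qPoch q nu (N i)
        / qPoch q (lam * nu) (M i + N i))
      = ∑ i ∈ B, b i * (nu ^ M' i * qPoch q lam (M' i) * qPoch q nu (N' i)
        / qPoch q (lam * nu) (M' i + N' i)) := by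
  have key : ∑ i ∈ A, a i • (X ^ M i * ∏ j ∈ Finset.range (N i), (1 - C (q ^ j) * X))
      = ∑ i ∈ B, b i • (X ^ M' i * ∏ j ∈ Finset.range (N' i), (1 - C (q ^ j) * X)) := by
    refine Polynomial.funext fun t => ?_
    simpa [eval_finsetSum, eval_prod, qPoch, mul_comm t] using h t
  have key := congrArg (qBetaMoment q lam nu) key
  simp only [map_sum, map_smul, smul_eq_mul] at key
  refine Eq.trans ?_ (key.trans ?_)
  · exact Finset.sum_congr rfl fun i hi => by rw [qBetaMoment_X_pow_mul_prod _ _ (hA i hi)]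
  · exact Finset.sum_congr rfl fun i hi => by rw [qBetaMoment_X_pow_mul_prod _ _ (hB i hi)]

theorem Bop_pow_single {n : ℕ} (i : Fin n) (k : ℕ) (f : Fin n → ℕ) :
    (Bop n i ^ k) (Finsupp.single f 1) = Finsupp.single (Function.update f i (f i + k)) 1 := by
  induction k with
  | zero => simp
  | succ k ih =>
    rw [pow_succ', Module.End.mul_apply, ih]
    simp [Bop, add_assoc]

theorem qPoch_inv_pow_eq_zero {q : ℂ} (hq0 : q ≠ 0) {k m : ℕ} (h : m < k) :
    qPoch q⁻¹ (q ^ m) k = 0 :=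
  Finset.prod_eq_zero (Finset.mem_range.2 h) (by simp [hq0])

theorem le_of_qPoch_inv_pow_ne_zero {q : ℂ} (hq0 : q ≠ 0) {k m : ℕ}
    (h : qPoch q⁻¹ (q ^ m) k ≠ 0) : k ≤ m :=
  le_of_not_gt fun hlt => h (qPoch_inv_pow_eq_zero hq0 hlt)

theorem Cop_pow_single {n : ℕ} {q : ℂ} (hq0 : q ≠ 0) (i : Fin n) (k : ℕ) (f : Fin n → ℕ) :
    (Cop n q i ^ k) (Finsupp.single f 1)
      = qPoch q⁻¹ (q ^ f i) k • Finsupp.single (Function.update f i (f i - k)) 1 := by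
  induction k with
  | zero => simp [qPoch_zero]
  | succ k ih =>
    rw [pow_succ', Module.End.mul_apply, ih, map_smul, qPoch_succ, mul_smul]
    rcases le_or_gt k (f i) with hk | hk
    · have e : q ^ f i * q⁻¹ ^ k = q ^ (f i - k) := by
        rw [pow_sub₀ q hq0 hk, inv_pow]
      simp [Cop, Nat.sub_sub, e, -Finsupp.smul_single, -inv_pow]
    · simp [qPoch_inv_pow_eq_zero hq0 hk]

/-- An ordered product of operators, each acting on its own tensor factor and sending basis vectors
to multiples of basis vectors. -/
theorem prod_map_apply_single {n : ℕ} (T : Fin n → Module.End ℂ (FockPow n))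
    (c : Fin n → ℕ → ℂ) (g : Fin n → ℕ → ℕ)
    (hT : ∀ i f, T i (Finsupp.single f 1)
      = c i (f i) • Finsupp.single (Function.update f i (g i (f i))) 1)
    (l : List (Fin n)) (hl : l.Nodup) (f : Fin n → ℕ) :
    (l.map T).prod (Finsupp.single f 1)
      = (l.map fun i => c i (f i)).prod
        • Finsupp.single (fun i => if i ∈ l then g i (f i) else f i) 1 := by
  induction l with
  | nil => simp
  | cons i l ih =>
    rw [List.nodup_cons] at hl
    rw [List.map_cons, List.prod_cons, Module.End.mul_apply, ih hl.2, map_smul, hT, smul_smul,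
      List.map_cons, List.prod_cons, mul_comm]
    simp only [hl.1, if_false]
    congr 2
    funext j
    by_cases hj : j = i
    · subst hj
      simp
    · simp [hj]

theorem prod_ofFn_apply_single {n : ℕ} (T : Fin n → Module.End ℂ (FockPow n))
    (c : Fin n → ℕ → ℂ) (g : Fin n → ℕ → ℕ)
    (hT : ∀ i f, T i (Finsupp.single f 1)
      = c i (f i) • Finsupp.single (Function.update f i (g i (f i))) 1) (f : Fin n → ℕ) :
    (List.ofFn T).prod (Finsupp.single f 1)
      = (∏ i, c i (f i)) • Finsupp.single (fun i => g i (f i)) 1 := by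
  rw [List.ofFn_eq_map, prod_map_apply_single T c g hT _ (List.nodup_finRange n)]
  simp [← List.ofFn_eq_map, List.prod_ofFn]

theorem prod_creation_annihilation_creation_apply {n : ℕ} {q : ℂ} (hq0 : q ≠ 0)
    (s m a f : Fin n → ℕ) (hm : m ≤ s) :
    (List.ofFn fun i : Fin n => Bop n i ^ (s i - m i) * Cop n q i ^ a i * Bop n i ^ m i).prod
        (Finsupp.single f 1)
      = (∏ i, qPoch q⁻¹ (q ^ f i * q ^ m i) (a i)) • Finsupp.single (f + s - a) 1 := by
  rw [prod_ofFn_apply_single _ (fun i k => qPoch q⁻¹ (q ^ (k + m i)) (a i))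
    (fun i k => k + m i - a i + (s i - m i))]
  · simp only [← pow_add]
    rcases eq_or_ne (∏ i, qPoch q⁻¹ (q ^ (f i + m i)) (a i)) 0 with h | h
    · simp [h]
    · congr 2
      funext i
      have h1 := le_of_qPoch_inv_pow_ne_zero hq0 (Finset.prod_ne_zero_iff.1 h i (Finset.mem_univ i))
      have h2 := hm i
      simp only [Pi.sub_apply, Pi.add_apply]
      lia
  · intro i f
    simp [Module.End.mul_apply, Bop_pow_single, Cop_pow_single hq0, -Finsupp.smul_single]

theorem prod_annihilation_creation_annihilation_apply {n : ℕ} {q : ℂ} (hq0 : q ≠ 0)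
    (s g a f : Fin n → ℕ) (hg : g ≤ a) :
    (List.ofFn fun i : Fin n => Cop n q i ^ g i * Bop n i ^ s i * Cop n q i ^ (a i - g i)).prod
        (Finsupp.single f 1)
      = (∏ i, qPoch q⁻¹ (q ^ f i) (a i - g i)
          * qPoch q⁻¹ (q ^ f i * q ^ s i * q⁻¹ ^ (a i - g i)) (g i))
        • Finsupp.single (f + s - a) 1 := by
  rw [prod_ofFn_apply_single _ (fun i k => qPoch q⁻¹ (q ^ k) (a i - g i)
    * qPoch q⁻¹ (q ^ (k - (a i - g i) + s i)) (g i)) (fun i k => k - (a i - g i) + s i - g i)]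
  · have e (i : Fin n) : qPoch q⁻¹ (q ^ f i) (a i - g i)
          * qPoch q⁻¹ (q ^ f i * q ^ s i * q⁻¹ ^ (a i - g i)) (g i)
        = qPoch q⁻¹ (q ^ f i) (a i - g i)
          * qPoch q⁻¹ (q ^ (f i - (a i - g i) + s i)) (g i) := by
      rcases lt_or_ge (f i) (a i - g i) with h | h
      · simp [qPoch_inv_pow_eq_zero hq0 h]
      · rw [pow_add, pow_sub₀ q hq0 h, inv_pow, mul_right_comm]
    simp only [e]
    rcases eq_or_ne (∏ i, qPoch q⁻¹ (q ^ f i) (a i - g i)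
      * qPoch q⁻¹ (q ^ (f i - (a i - g i) + s i)) (g i)) 0 with h | h
    · simp [h]
    · congr 2
      funext i
      have h0 := Finset.prod_ne_zero_iff.1 h i (Finset.mem_univ i)
      have h1 := le_of_qPoch_inv_pow_ne_zero hq0 (left_ne_zero_of_mul h0)
      have h2 := le_of_qPoch_inv_pow_ne_zero hq0 (right_ne_zero_of_mul h0)
      have h3 := hg i
      simp only [Pi.sub_apply, Pi.add_apply]
      lia
  · intro i f
    simp [Module.End.mul_apply, Bop_pow_single, Cop_pow_single hq0, smul_smul,
      -Finsupp.smul_single]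

theorem Phi_of_le {k : ℕ} {q lam nu : ℂ} (hlam : lam ≠ 0) {γ β : Fin k → ℕ} (h : γ ≤ β) :
    Phi k q lam (lam * nu) γ β = q ^ natPhi (β - γ) γ * (∏ i, qBinom q (β i) (γ i))
      * (nu ^ (∑ i, γ i) * qPoch q lam (∑ i, γ i) * qPoch q nu (∑ i, (β - γ) i)
        / qPoch q (lam * nu) (∑ i, γ i + ∑ i, (β - γ) i)) := by
  have e : (fun i => (β i : ℤ) - (γ i : ℤ)) = fun i => ((β - γ) i : ℤ) := by
    funext i
    rw [Pi.sub_apply, Nat.cast_sub (h i)]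
  rw [Phi, if_pos h, e, phi_natCast, zpow_natCast, mul_div_cancel_left₀ _ hlam,
    ← sum_add_sum_sub h, Nat.add_sub_cancel_left]
  ring

/-- The operator identity (mrng) of Kuniba–Okado:
`Σ_{m ≤ s} q^{φ(m,α)} Φ_q^{(n)}(m|s;λ,μ) ∏_i b_i^{s_i−m_i} c_i^{α_i} b_i^{m_i}
 = Σ_{γ ≤ α} q^{φ(γ,α)+φ(s,γ)−φ(α,γ)} Φ_q^{(n+1)}(γ|α;λ,μ) ∏_i c_i^{γ_i} b_i^{s_i} c_i^{α_i−γ_i}`,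
where the length-`n` vectors `m`, `s` are padded with a trailing zero inside `φ`. -/
theorem mrng_identity (n : ℕ) (hn : 1 ≤ n) (q : ℂ) (hq0 : q ≠ 0) (hq : notRootOfUnity q)
    (lam mu : ℂ) (hlam : lam ≠ 0) (s : Fin n → ℕ) (α : Fin (n + 1) → ℕ)
    (hs : qPoch q mu (∑ i, s i) ≠ 0) (hα : qPoch q mu (∑ i, α i) ≠ 0) :
    ∑ m ∈ Finset.Iic s,
      (q ^ phi (fun i => ((Fin.snoc m 0 : Fin (n + 1) → ℕ) i : ℤ)) (fun i => (α i : ℤ))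
          * Phi n q lam mu m s) •
        (List.ofFn fun i : Fin n =>
          Bop n i ^ (s i - m i) * Cop n q i ^ (α i.castSucc) * Bop n i ^ (m i)).prod
    = ∑ γ ∈ Finset.Iic α,
        (q ^ (phi (fun i => (γ i : ℤ)) (fun i => (α i : ℤ))
              + phi (fun i => ((Fin.snoc s 0 : Fin (n + 1) → ℕ) i : ℤ)) (fun i => (γ i : ℤ))
              - phi (fun i => (α i : ℤ)) (fun i => (γ i : ℤ)))
            * Phi (n + 1) q lam mu γ α) •
          (List.ofFn fun i : Fin n =>
            Cop n q i ^ (γ i.castSucc) * Bop n i ^ (s i)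
              * Cop n q i ^ (α i.castSucc - γ i.castSucc)).prod := by
  obtain ⟨nu, rfl⟩ : ∃ nu, mu = lam * nu := ⟨mu / lam, (mul_div_cancel₀ mu hlam).symm⟩
  refine Finsupp.lhom_ext' fun f => LinearMap.ext_ring ?_
  have key := sum_qHahn_eq_of_sum_pow_mul_qPoch_eq (q := q) (lam := lam) (nu := nu)
    (Finset.Iic s) (Finset.Iic α) _ _ _ _ _ _
    (fun m hm => by rwa [sum_add_sum_sub (Finset.mem_Iic.1 hm)])
    (fun γ hγ => by rwa [sum_add_sum_sub (Finset.mem_Iic.1 hγ)])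
    (sum_natPhi_pow_mul_qPoch_eq hq0 hq n s α fun i => q ^ f i)
  have key := congrArg
    (· • (Finsupp.single (f + s - fun i => α i.castSucc) 1 : FockPow n)) key
  simp only [Finset.sum_smul] at key
  simp only [LinearMap.comp_apply, LinearMap.sum_apply, LinearMap.smul_apply,
    Finsupp.lsingle_apply]
  refine Eq.trans ?_ (key.trans ?_)
  · refine Finset.sum_congr rfl fun m hm => ?_
    rw [Finset.mem_Iic] at hm
    rw [prod_creation_annihilation_creation_apply hq0 s m (fun i => α i.castSucc) f hm, smul_smul,
      Phi_of_le hlam hm, phi_natCast, zpow_natCast]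
    congr 1
    ring
  · refine Finset.sum_congr rfl fun γ hγ => ?_
    rw [Finset.mem_Iic] at hγ
    rw [prod_annihilation_creation_annihilation_apply hq0 s (fun i => γ i.castSucc)
      (fun i => α i.castSucc) f fun i => hγ i.castSucc, smul_smul, Phi_of_le hlam hγ]
    have hexp : q ^ (phi (fun i => (γ i : ℤ)) (fun i => (α i : ℤ))
          + phi (fun i => ((Fin.snoc s 0 : Fin (n + 1) → ℕ) i : ℤ)) (fun i => (γ i : ℤ))
          - phi (fun i => (α i : ℤ)) (fun i => (γ i : ℤ))) * q ^ natPhi (α - γ) γ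
        = q ^ (natPhi γ (α - γ) + natPhi (Fin.snoc s 0 : Fin (n + 1) → ℕ) γ) := by
      obtain ⟨δ, rfl⟩ := exists_add_of_le hγ
      rw [phi_natCast, phi_natCast, phi_natCast, ← zpow_natCast, ← zpow_natCast, ← zpow_add₀ hq0,
        add_tsub_cancel_left, natPhi_add_left, natPhi_add_right]
      congr 1
      push_cast
      ring
    rw [← hexp]
    congr 1
    ring
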